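/- arXiv:2507.08411 — 2 statements merged into one kernel-verified Lean document; each statement's English description precedes it below -/
import Mathlib

section
/- Let m, n ∈ ℕ, let A be a real m×m matrix, B a real m×n matrix, C a real n×m matrix, D a real n×n matrix, P a real symmetric m×m matrix, and a, b, c ∈ ℝ. Suppose the linear matrix inequality holds in the form: for all x ∈ ℝ^m and u ∈ ℝ^n, 2·xᵀP(Ax + Bu) ≤ a·‖Cx + Du‖² + 2b·(Cx + Du)ᵀu + c·‖u‖². Let u : [0,∞) → ℝ^n and let x : [0,∞) → ℝ^m be differentiable with x'(t) = A·x(t) + B·u(t) for all t ≥ 0, x(0) = 0, and x(t) → 0 as t → ∞; define y(t) := C·x(t) + D·u(t), and suppose the function t ↦ a·‖y(t)‖² + 2b·y(t)ᵀu(t) + c·‖u(t)‖² is integrable on [0,∞). Then ∫₀^∞ (a·‖y(t)‖² + 2b·y(t)ᵀu(t) + c·‖u(t)‖²) dt ≥ 0. -/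
open Matrix MeasureTheory

/-- Product rule for the dot product of two vector-valued functions of a real variable. -/
theorem HasDerivWithinAt.dotProduct {ι : Type*} [Fintype ι] {f g : ℝ → ι → ℝ} {f' g' : ι → ℝ}
    {s : Set ℝ} {t : ℝ} (hf : HasDerivWithinAt f f' s t) (hg : HasDerivWithinAt g g' s t) :
    HasDerivWithinAt (fun r => f r ⬝ᵥ g r) (f' ⬝ᵥ g t + f t ⬝ᵥ g') s t := by
  have h := HasDerivWithinAt.fun_sum (u := Finset.univ) fun i _ =>
    (hasDerivWithinAt_pi.1 hf i).fun_mul (hasDerivWithinAt_pi.1 hg i)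
  simpa only [_root_.dotProduct, Finset.sum_add_distrib] using h

/-- Multiplication by a constant matrix commutes with differentiation. -/
theorem HasDerivWithinAt.matrix_mulVec {ι κ : Type*} [Finite ι] [Fintype κ] (M : Matrix ι κ ℝ)
    {f : ℝ → κ → ℝ} {f' : κ → ℝ} {s : Set ℝ} {t : ℝ} (hf : HasDerivWithinAt f f' s t) :
    HasDerivWithinAt (fun r => M *ᵥ f r) (M *ᵥ f') s t :=
  have := Fintype.ofFinite ι
  M.mulVecLin.toContinuousLinearMap.hasFDerivAt.comp_hasDerivWithinAt t hf

/-- The derivative of a symmetric quadratic form along a differentiable curve. -/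
theorem HasDerivWithinAt.quadraticForm {ι : Type*} [Fintype ι] {P : Matrix ι ι ℝ} (hP : P.IsSymm)
    {f : ℝ → ι → ℝ} {f' : ι → ℝ} {s : Set ℝ} {t : ℝ} (hf : HasDerivWithinAt f f' s t) :
    HasDerivWithinAt (fun r => f r ⬝ᵥ P *ᵥ f r) (2 * (f t ⬝ᵥ P *ᵥ f')) s t := by
  have hsymm : f' ⬝ᵥ P *ᵥ f t = f t ⬝ᵥ P *ᵥ f' := by
    rw [dotProduct_mulVec, ← mulVec_transpose, hP.eq, dotProduct_comm]
  have h := hf.dotProduct (hf.matrix_mulVec P)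
  rwa [hsymm, ← two_mul] at h

/-- A storage function that starts at zero, tends to zero and grows no faster than an integrable
supply rate forces the total supply to be nonnegative. -/
theorem integral_Ici_nonneg_of_hasDerivWithinAt_le {V V' φ : ℝ → ℝ}
    (hV : ∀ t, 0 ≤ t → HasDerivWithinAt V (V' t) (Set.Ici 0) t) (hV0 : V 0 = 0)
    (hVlim : Filter.Tendsto V Filter.atTop (nhds 0)) (hφ : IntegrableOn φ (Set.Ici 0))
    (hle : ∀ t, 0 ≤ t → V' t ≤ φ t) : 0 ≤ ∫ t in Set.Ici (0 : ℝ), φ t := by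
  rw [integral_Ici_eq_integral_Ioi]
  refine le_of_tendsto_of_tendsto hVlim (intervalIntegral_tendsto_integral_Ioi 0
    (hφ.mono_set Set.Ioi_subset_Ici_self) Filter.tendsto_id) ?_
  filter_upwards [Filter.eventually_ge_atTop 0] with T hT
  have h := intervalIntegral.sub_le_integral_of_hasDeriv_right_of_le hT
    (fun t ht => (hV t ht.1).continuousWithinAt.mono Set.Icc_subset_Ici_self)
    (fun t ht => (hV t ht.1.le).mono fun r hr => ht.1.le.trans (le_of_lt hr))
    (hφ.mono_set Set.Icc_subset_Ici_self) (fun t ht => hle t ht.1.le)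
  simpa [hV0] using h

/-- Theorem 4, implication (1) ⇒ (2): feasibility of the KYP-type LMI
`[A B; I 0]ᵀ[0 P; P 0][A B; I 0] − Θ(Π) ⪯ 0` (expressed as a quadratic-form inequality)
implies that the LTI system `ẋ = Ax + Bu`, `y = Cx + Du` (initially at rest, with state
converging to zero) satisfies the IQC `∫₀^∞ (a‖y‖² + 2b yᵀu + c‖u‖²) dt ≥ 0`. -/
theorem kyp_lmi_implies_iqc {m n : ℕ}
    (A : Matrix (Fin m) (Fin m) ℝ) (B : Matrix (Fin m) (Fin n) ℝ)
    (C : Matrix (Fin n) (Fin m) ℝ) (D : Matrix (Fin n) (Fin n) ℝ)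
    (P : Matrix (Fin m) (Fin m) ℝ) (hP : P.IsSymm) (a b c : ℝ)
    (hLMI : ∀ (x : Fin m → ℝ) (u : Fin n → ℝ),
      2 * (x ⬝ᵥ P.mulVec (A.mulVec x + B.mulVec u)) ≤
        a * ((C.mulVec x + D.mulVec u) ⬝ᵥ (C.mulVec x + D.mulVec u)) +
          2 * b * ((C.mulVec x + D.mulVec u) ⬝ᵥ u) + c * (u ⬝ᵥ u))
    (u : ℝ → Fin n → ℝ) (x : ℝ → Fin m → ℝ)
    (hx : ∀ t, 0 ≤ t → HasDerivWithinAt x (A.mulVec (x t) + B.mulVec (u t)) (Set.Ici 0) t)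
    (hx0 : x 0 = 0)
    (hxlim : Filter.Tendsto x Filter.atTop (nhds 0))
    (y : ℝ → Fin n → ℝ) (hy : ∀ t, y t = C.mulVec (x t) + D.mulVec (u t))
    (hint : IntegrableOn
      (fun t => a * (y t ⬝ᵥ y t) + 2 * b * (y t ⬝ᵥ u t) + c * (u t ⬝ᵥ u t)) (Set.Ici 0)) :
    0 ≤ ∫ t in Set.Ici (0 : ℝ),
      (a * (y t ⬝ᵥ y t) + 2 * b * (y t ⬝ᵥ u t) + c * (u t ⬝ᵥ u t)) := by
  refine integral_Ici_nonneg_of_hasDerivWithinAt_le (V := fun t => x t ⬝ᵥ P *ᵥ x t)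
    (fun t ht => (hx t ht).quadraticForm hP) (by simp [hx0]) ?_ hint fun t _ => ?_
  · have hcont : Continuous fun v : Fin m → ℝ => v ⬝ᵥ P *ᵥ v := by fun_prop
    simpa [Function.comp_def] using (hcont.tendsto 0).comp hxlim
  · simpa only [hy] using hLMI (x t) (u t)
end

section
/- Let m, n ∈ ℕ, let A, R be real m×m matrices, B a real m×n matrix, C a real n×m matrix, D a real n×n matrix, P a real symmetric m×m matrix, M a real symmetric (m+n)×(m+n) matrix, τ₁, τ₂ ≥ 0, and a, b, c ∈ ℝ. Suppose: (i) for all x ∈ ℝ^m and u ∈ ℝ^n, writing ξ = (x,u) ∈ ℝ^{m+n}, 2·xᵀP(Ax + Bu) + τ₁·ξᵀMξ ≤ a·‖Cx + Du‖² + 2b·(Cx + Du)ᵀu + c·‖u‖²; and (ii) for all ξ = (x,u) ∈ ℝ^{m+n}, xᵀ(RᵀPR − P)x ≤ τ₂·ξᵀMξ. Let 0 < t₁ < t₂ < ⋯ be a strictly increasing (finite or infinite, and if infinite tending to ∞) sequence of reset times, let u : [0,∞) → ℝ^n, and let x : [0,∞) → ℝ^m be right-continuous, continuous and differentiable on the complement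 of the reset times with x'(t) = A·x(t) + B·u(t) and (x(t),u(t))ᵀM(x(t),u(t)) ≥ 0 there; at each reset time t_k the left limit x(t_k⁻) := lim_{s↑t_k} x(s) exists, (x(t_k⁻),u(t_k))ᵀM(x(t_k⁻),u(t_k)) ≤ 0, and x(t_k) = R·x(t_k⁻). Assume x(0) = 0, x(t) → 0 as t → ∞, and that t ↦ a·‖y(t)‖² + 2b·y(t)ᵀu(t) + c·‖u(t)‖² is integrable on [0,∞), where y(t) := C·x(t) + D·u(t). Then ∫₀^∞ (a·‖y(t)‖² + 2b·y(t)ᵀu(t) + c·‖u(t)‖²) dt ≥ 0. -/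
open Matrix MeasureTheory

open Set Filter Topology

/-- A locally finite set of reals is avoided near every point outside it. -/
theorem compl_mem_nhds_of_finite_inter_Iic {T : Set ℝ} (hT : ∀ s : ℝ, (T ∩ Iic s).Finite)
    {t : ℝ} (ht : t ∉ T) : Tᶜ ∈ 𝓝 t := by
  have h : (T ∩ Iic (t + 1))ᶜ ∈ 𝓝 t :=
    (hT (t + 1)).isClosed.isOpen_compl.mem_nhds fun h => ht h.1
  filter_upwards [h, Iio_mem_nhds (lt_add_one t)] with s hs hs' hsT
  exact hs ⟨hsT, (mem_Iio.1 hs').le⟩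

/-- A right-continuous function whose derivative is bounded by `φ` away from a locally finite set
of downward jumps grows by at most the integral of `φ`. -/
theorem sub_le_integral_of_hasDerivAt_of_jump_le {f f' φ : ℝ → ℝ} {T : Set ℝ}
    (hTpos : T ⊆ Ioi 0) (hT : ∀ s : ℝ, (T ∩ Iic s).Finite)
    (hrc : ∀ t, 0 ≤ t → ContinuousWithinAt f (Ici t) t)
    (hderiv : ∀ t, 0 < t → t ∉ T → HasDerivAt f (f' t) t)
    (hle : ∀ t, 0 < t → t ∉ T → f' t ≤ φ t)
    (hjump : ∀ t ∈ T, ∃ l, Tendsto f (𝓝[<] t) (𝓝 l) ∧ f t ≤ l)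
    (hφ : IntegrableOn φ (Ici 0)) {t : ℝ} (ht : 0 ≤ t) :
    f t - f 0 ≤ ∫ s in (0 : ℝ)..t, φ s := by
  have hφ' (r s : ℝ) (hr : 0 ≤ r) : IntegrableOn φ (Icc r s) :=
    hφ.mono_set fun _ h => hr.trans h.1
  have hflow (r s : ℝ) (hr : 0 ≤ r) (hrs : r ≤ s) (hempty : ∀ q ∈ Ioc r s, q ∉ T) :
      f s - f r ≤ ∫ q in r..s, φ q := by
    refine intervalIntegral.sub_le_integral_of_hasDeriv_right_of_le (g' := f') hrs ?_ ?_
      (hφ' r s hr) fun q hq => hle q (hr.trans_lt hq.1) (hempty q ⟨hq.1, hq.2.le⟩)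
    · intro q hq
      rcases hq.1.eq_or_lt with rfl | hrq
      · exact (hrc r hr).mono Icc_subset_Ici_self
      · exact (hderiv q (hr.trans_lt hrq)
          (hempty q ⟨hrq, hq.2⟩)).continuousAt.continuousWithinAt
    · intro q hq
      exact (hderiv q (hr.trans_lt hq.1) (hempty q ⟨hq.1, hq.2.le⟩)).hasDerivWithinAt
  induction hN : (T ∩ Iic t).ncard using Nat.strong_induction_on generalizing t with
  | _ N ih =>
    rcases (T ∩ Iic t).eq_empty_or_nonempty with hempty | hne
    · exact hflow 0 t le_rfl ht fun q hq hqT =>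
        (hempty ▸ (⟨hqT, hq.2⟩ : q ∈ T ∩ Iic t) : q ∈ (∅ : Set ℝ))
    obtain ⟨r, ⟨hrT, hrt⟩, hmax⟩ := (hT t).exists_maximal hne
    have hr : 0 < r := hTpos hrT
    have hlast : f t - f r ≤ ∫ q in r..t, φ q :=
      hflow r t hr.le hrt fun q hq hqT => hq.1.not_ge (hmax ⟨hqT, hq.2⟩ hq.1.le)
    obtain ⟨l, hl, hrl⟩ := hjump r hrT
    have hbefore : ∀ᶠ s in 𝓝[<] r, f s - f 0 ≤ ∫ q in (0 : ℝ)..s, φ q := by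
      filter_upwards [Ioo_mem_nhdsLT hr] with s hs
      refine ih _ ?_ hs.1.le rfl
      rw [← hN]
      refine Set.ncard_lt_ncard ⟨fun q hq => ⟨hq.1, hq.2.trans (hs.2.le.trans hrt)⟩, ?_⟩ (hT t)
      exact fun h => hs.2.not_ge (h ⟨hrT, hrt⟩).2
    have hprim : Tendsto (fun s => ∫ q in (0 : ℝ)..s, φ q) (𝓝[<] r)
        (𝓝 (∫ q in (0 : ℝ)..r, φ q)) := by
      have hcont := intervalIntegral.continuousOn_primitive_interval (a := 0) (b := r)
        (uIcc_of_le hr.le ▸ hφ' 0 r le_rfl) r right_mem_uIcc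
      rw [uIcc_of_le hr.le] at hcont
      exact hcont.tendsto.mono_left
        (nhdsWithin_le_of_mem (mem_of_superset (Ioo_mem_nhdsLT hr) Ioo_subset_Icc_self))
    have hlimit := le_of_tendsto_of_tendsto (hl.sub_const (f 0)) hprim hbefore
    have hint (p q : ℝ) (hp : 0 ≤ p) (hpq : p ≤ q) : IntervalIntegrable φ volume p q :=
      (intervalIntegrable_iff_integrableOn_Icc_of_le hpq).2 (hφ' p q hp)
    rw [← intervalIntegral.integral_add_adjacent_intervals (hint 0 r le_rfl hr.le)
      (hint r t hr.le hrt)]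
    linarith

/-- The derivative of a symmetric quadratic form along a curve. -/
theorem HasDerivAt.dotProduct_mulVec_self {ι : Type*} [Fintype ι] {P : Matrix ι ι ℝ}
    (hP : P.IsSymm) {x : ℝ → ι → ℝ} {x' : ι → ℝ} {t : ℝ} (hx : HasDerivAt x x' t) :
    HasDerivAt (fun s => x s ⬝ᵥ P *ᵥ x s) (2 * (x t ⬝ᵥ P *ᵥ x')) t := by
  have hxi := hasDerivAt_pi.1 hx
  have h : HasDerivAt (fun s => x s ⬝ᵥ P *ᵥ x s)
      (∑ i, (x' i * (P *ᵥ x t) i + x t i * (P *ᵥ x') i)) t :=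
    HasDerivAt.fun_sum fun i _ => (hxi i).mul
      (HasDerivAt.fun_sum fun j _ => (hxi j).const_mul (P i j))
  convert h using 1
  rw [Finset.sum_add_distrib]
  change 2 * (x t ⬝ᵥ P *ᵥ x') = x' ⬝ᵥ P *ᵥ x t + x t ⬝ᵥ P *ᵥ x'
  rw [← Matrix.dotProduct_transpose_mulVec, hP.eq]
  ring

/-- Theorem 7 (reset/impulsive systems): if the flow LMI
`[A B; I 0]ᵀ[0 P; P 0][A B; I 0] − Θ(Π) + τ₁M ⪯ 0` and the jump LMI
`[RᵀPR − P, 0; 0, 0] − τ₂M ⪯ 0` hold (expressed as quadratic-form inequalities), then any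
trajectory of the reset system `ẋ = Ax + Bu` (flowing in `{ξ | ξᵀMξ ≥ 0}`), `x ↦ Rx` at
isolated reset times (taken in the jump set `{ξ | ξᵀMξ ≤ 0}`), `y = Cx + Du`, starting at
rest with state converging to zero, satisfies the IQC
`∫₀^∞ (a‖y‖² + 2b yᵀu + c‖u‖²) dt ≥ 0`. -/
theorem reset_lmi_implies_iqc {m n : ℕ}
    (A R : Matrix (Fin m) (Fin m) ℝ) (B : Matrix (Fin m) (Fin n) ℝ)
    (C : Matrix (Fin n) (Fin m) ℝ) (D : Matrix (Fin n) (Fin n) ℝ)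
    (P : Matrix (Fin m) (Fin m) ℝ) (hP : P.IsSymm)
    (M : Matrix (Fin (m + n)) (Fin (m + n)) ℝ) (hM : M.IsSymm)
    (τ₁ τ₂ : ℝ) (hτ₁ : 0 ≤ τ₁) (hτ₂ : 0 ≤ τ₂) (a b c : ℝ)
    -- (i) flow LMI as a quadratic-form inequality
    (hLMI₁ : ∀ (x : Fin m → ℝ) (u : Fin n → ℝ),
      2 * (x ⬝ᵥ P.mulVec (A.mulVec x + B.mulVec u)) +
          τ₁ * (Fin.append x u ⬝ᵥ M.mulVec (Fin.append x u)) ≤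
        a * ((C.mulVec x + D.mulVec u) ⬝ᵥ (C.mulVec x + D.mulVec u)) +
          2 * b * ((C.mulVec x + D.mulVec u) ⬝ᵥ u) + c * (u ⬝ᵥ u))
    -- (ii) jump LMI as a quadratic-form inequality
    (hLMI₂ : ∀ (x : Fin m → ℝ) (u : Fin n → ℝ),
      x ⬝ᵥ (Rᵀ * P * R - P).mulVec x ≤ τ₂ * (Fin.append x u ⬝ᵥ M.mulVec (Fin.append x u)))
    -- reset times: a set of positive times whose bounded portions are finite
    (T : Set ℝ) (hTpos : T ⊆ Set.Ioi 0) (hTfin : ∀ s : ℝ, (T ∩ Set.Iic s).Finite)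
    (u : ℝ → Fin n → ℝ) (x : ℝ → Fin m → ℝ)
    -- right-continuity of the state
    (hrc : ∀ t, 0 ≤ t → ContinuousWithinAt x (Set.Ici t) t)
    -- flow dynamics and flow-set membership away from reset times
    (hflow : ∀ t, 0 ≤ t → t ∉ T →
      HasDerivWithinAt x (A.mulVec (x t) + B.mulVec (u t)) (Set.Ici 0 \ T) t ∧
        0 ≤ Fin.append (x t) (u t) ⬝ᵥ M.mulVec (Fin.append (x t) (u t)))
    -- jump behaviour at reset times: left limit exists, lies in the jump set, and is reset
    (hjump : ∀ t ∈ T, ∃ xl : Fin m → ℝ,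
      Filter.Tendsto x (nhdsWithin t (Set.Iio t)) (nhds xl) ∧
        Fin.append xl (u t) ⬝ᵥ M.mulVec (Fin.append xl (u t)) ≤ 0 ∧
        x t = R.mulVec xl)
    (hx0 : x 0 = 0)
    (hxlim : Filter.Tendsto x Filter.atTop (nhds 0))
    (y : ℝ → Fin n → ℝ) (hy : ∀ t, y t = C.mulVec (x t) + D.mulVec (u t))
    (hint : IntegrableOn
      (fun t => a * (y t ⬝ᵥ y t) + 2 * b * (y t ⬝ᵥ u t) + c * (u t ⬝ᵥ u t)) (Set.Ici 0)) :
    0 ≤ ∫ t in Set.Ici (0 : ℝ),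
      (a * (y t ⬝ᵥ y t) + 2 * b * (y t ⬝ᵥ u t) + c * (u t ⬝ᵥ u t)) := by
  have hV : Continuous fun v : Fin m → ℝ => v ⬝ᵥ P *ᵥ v :=
    continuous_id.dotProduct (continuous_const.matrix_mulVec continuous_id)
  have hbound : ∀ t, 0 ≤ t → x t ⬝ᵥ P *ᵥ x t ≤ ∫ s in (0 : ℝ)..t,
      (a * (y s ⬝ᵥ y s) + 2 * b * (y s ⬝ᵥ u s) + c * (u s ⬝ᵥ u s)) := by
    intro t ht
    have h := sub_le_integral_of_hasDerivAt_of_jump_le (f := fun t => x t ⬝ᵥ P *ᵥ x t)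
      (f' := fun t => 2 * (x t ⬝ᵥ P *ᵥ (A *ᵥ x t + B *ᵥ u t))) hTpos hTfin
      (fun t ht => hV.continuousAt.comp_continuousWithinAt (hrc t ht)) ?_ ?_ ?_ hint ht
    · simpa [hx0] using h
    · intro t ht htT
      refine HasDerivAt.dotProduct_mulVec_self hP ((hflow t ht.le htT).1.hasDerivAt ?_)
      exact inter_mem (Ici_mem_nhds ht) (compl_mem_nhds_of_finite_inter_Iic hTfin htT)
    · intro t ht htT
      have h := hLMI₁ (x t) (u t)
      have hτM := mul_nonneg hτ₁ (hflow t ht.le htT).2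
      rw [hy t]
      linarith
    · intro t htT
      obtain ⟨xl, hxl, hMxl, hR⟩ := hjump t htT
      refine ⟨xl ⬝ᵥ P *ᵥ xl, (hV.tendsto xl).comp hxl, ?_⟩
      have h := (hLMI₂ xl (u t)).trans (mul_nonpos_of_nonneg_of_nonpos hτ₂ hMxl)
      have hRP : xl ⬝ᵥ (Rᵀ * P * R) *ᵥ xl = (R *ᵥ xl) ⬝ᵥ P *ᵥ (R *ᵥ xl) := by
        rw [← mulVec_mulVec, ← mulVec_mulVec, dotProduct_transpose_mulVec, dotProduct_comm]
      rw [sub_mulVec, dotProduct_sub, hRP] at h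
      simp only [hR]
      linarith
  have hVlim : Tendsto (fun t => x t ⬝ᵥ P *ᵥ x t) atTop (𝓝 0) := by
    simpa [Function.comp_def] using (hV.tendsto 0).comp hxlim
  rw [integral_Ici_eq_integral_Ioi]
  exact le_of_tendsto_of_tendsto hVlim
    (intervalIntegral_tendsto_integral_Ioi 0 (hint.mono_set Ioi_subset_Ici_self) tendsto_id)
    ((eventually_ge_atTop 0).mono hbound)
end
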